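/- arXiv:2504.21824 — 3 statements merged into one kernel-verified Lean document; each statement's English description precedes it below -/
import Mathlib

section
/- Let α, p, m be integers with 0 ≤ p ≤ α, 0 ≤ m ≤ 2p, and m ≤ α + p - 1. Then Σ_{q=0}^{p} C(α-q, p-q) · C(2α-m, 2q-m) = 2^{2p-m} C(α+p-m-1, 2p-m) + 2^{2p-m-1} C(α+p-m-1, 2p-m-1), where C(n,k) denotes the binomial coefficient with the convention C(n,k) = 0 whenever k < 0 or k > n. -/
/-- Binomial coefficient on the integers, with the convention that `C(n,k) = 0`
whenever `k < 0` or `k > n`. -/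
def ichoose (n k : ℤ) : ℤ :=
  if 0 ≤ k ∧ k ≤ n then (n.toNat).choose k.toNat else 0

open PowerSeries in
/-- Expanding `(1 - X)⁻ᵈ` along `X ↦ X ^ 2` and multiplying by `(1 + X) ^ d` gives `(1 - X)⁻ᵈ`. -/
theorem expand_two_mk_choose_mul_one_add_pow (a : ℕ) :
    expand 2 two_ne_zero (mk fun k ↦ ((a + k).choose a : ℤ)) * (1 + X) ^ (a + 1)
      = mk fun k ↦ ((a + k).choose a : ℤ) := by
  have h := mk_add_choose_mul_one_sub_pow_eq_one ℤ a
  have h2 := congrArg (expand 2 two_ne_zero) h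
  rw [map_mul, map_pow, map_sub, map_one, expand_X,
    show (1 - X ^ 2 : ℤ⟦X⟧) = (1 + X) * (1 - X) by ring, mul_pow, ← mul_assoc] at h2
  exact mul_right_cancel₀ (right_ne_zero_of_mul_eq_one h) (h2.trans h.symm)

open PowerSeries in
theorem coeff_one_add_X_pow_int (N k : ℕ) :
    coeff k ((1 + X : ℤ⟦X⟧) ^ N) = N.choose k := by
  have h : ((1 + X : ℤ⟦X⟧) ^ N) = (((1 + Polynomial.X) ^ N : Polynomial ℤ) : ℤ⟦X⟧) := by
    simp
  rw [h, Polynomial.coeff_coe, Polynomial.coeff_one_add_X_pow]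

open PowerSeries in
theorem coeff_one_add_pow_mul_mk_choose (a n : ℕ) :
    coeff n ((1 + X : ℤ⟦X⟧) ^ (a + n) * mk fun k ↦ ((a + k).choose a : ℤ))
      = 2 ^ n * (a + n).choose n := by
  rw [coeff_mul, Finset.Nat.sum_antidiagonal_eq_sum_range_succ_mk]
  simp only [coeff_one_add_X_pow_int, coeff_mk]
  have h : ∀ i ∈ Finset.range (n + 1),
      ((a + n).choose i : ℤ) * ((a + (n - i)).choose a : ℤ) = (a + n).choose n * n.choose i := by
    intro i hi
    have hi : i ≤ n := Finset.mem_range_succ_iff.mp hi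
    rw [← Nat.choose_symm (n := a + n) (k := i) (by omega), Nat.add_sub_assoc hi]
    norm_cast
    rw [Nat.choose_mul (by omega), Nat.add_sub_cancel_left, Nat.add_sub_cancel_left,
      Nat.choose_symm hi, Nat.choose_symm_add]
  rw [Finset.sum_congr rfl h, ← Finset.mul_sum, mul_comm]
  congr 1
  exact_mod_cast Nat.sum_range_choose n

open PowerSeries in
theorem coeff_succ_one_add_pow_mul_mk_choose (a t : ℕ) :
    coeff (t + 1) ((1 + X : ℤ⟦X⟧) ^ (a + t) * mk fun k ↦ ((a + k).choose a : ℤ))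
      = 2 ^ (t + 1) * (a + t).choose (t + 1) + 2 ^ t * (a + t).choose t := by
  have h := coeff_one_add_pow_mul_mk_choose a (t + 1)
  rw [← add_assoc, pow_succ', mul_assoc, add_mul, one_mul, map_add, coeff_succ_X_mul,
    coeff_one_add_pow_mul_mk_choose, Nat.choose_succ_succ'] at h
  push_cast at h
  linear_combination h

open PowerSeries in
theorem sum_choose_mul_choose_even (a N n : ℕ) :
    (∑ i ∈ Finset.range (n + 1),
      (if 2 ∣ i then ((a + i / 2).choose a : ℤ) else 0) * (N + (a + 1)).choose (n - i))
      = coeff n ((1 + X : ℤ⟦X⟧) ^ N * mk fun k ↦ ((a + k).choose a : ℤ)) := by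
  rw [← expand_two_mk_choose_mul_one_add_pow, mul_left_comm, ← pow_add, coeff_mul,
    Finset.Nat.sum_antidiagonal_eq_sum_range_succ_mk]
  simp only [coeff_expand, coeff_one_add_X_pow_int, coeff_mk]

theorem ichoose_natCast (n k : ℕ) : ichoose n k = n.choose k := by
  by_cases h : k ≤ n
  · simp [ichoose, h]
  · simp [ichoose, h, Nat.choose_eq_zero_of_lt (not_le.mp h)]

theorem ichoose_of_neg (n : ℤ) {k : ℤ} (h : k < 0) : ichoose n k = 0 :=
  if_neg fun hk ↦ absurd hk.1 (not_le.mpr h)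

theorem sum_Icc_ichoose_eq_sum_range (a p n : ℕ) (m : ℤ) (hm0 : 0 ≤ m) (hn : 2 * p - m = n) :
    ∑ q ∈ Finset.Icc (0 : ℤ) p,
        ichoose (p + a - q) (p - q) * ichoose (2 * (p + a) - m) (2 * q - m)
      = ∑ i ∈ Finset.range (n + 1),
        (if 2 ∣ i then ((a + i / 2).choose a : ℤ) else 0) * (2 * a + n).choose (n - i) := by
  have term : ∀ k : ℕ, 2 * k ≤ n →
      ichoose (p + a - (p - k)) (p - (p - k)) * ichoose (2 * (p + a) - m) (2 * (p - k) - m)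
        = ((a + k).choose a : ℤ) * (2 * a + n).choose (n - 2 * k) := by
    intro k hk
    rw [show (p + a - (p - k) : ℤ) = (a + k : ℕ) by push_cast; ring,
      show (p - (p - k) : ℤ) = k by ring,
      show 2 * (p + a) - m = (2 * a + n : ℕ) by push_cast; linarith,
      show 2 * (p - k) - m = (n - 2 * k : ℕ) by omega,
      ichoose_natCast, ichoose_natCast, Nat.choose_symm_add]
  have nonneg_of_ne : ∀ q : ℤ,
      ichoose (p + a - q) (p - q) * ichoose (2 * (p + a) - m) (2 * q - m) ≠ 0 → m ≤ 2 * q := by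
    intro q hq
    by_contra! h
    exact hq (by rw [ichoose_of_neg (2 * (p + a) - m) (by omega : 2 * q - m < 0), mul_zero])
  refine Finset.sum_bij_ne_zero (fun q _ _ ↦ (2 * (p - q)).toNat) ?_ ?_ ?_ ?_
  · intro q hq h
    have := nonneg_of_ne q h
    rw [Finset.mem_range]
    omega
  · intro q hq h q' hq' h' e
    rw [Finset.mem_Icc] at hq hq'
    omega
  · intro i hi h
    obtain ⟨k, rfl⟩ : 2 ∣ i := by
      by_contra hk
      simp [hk] at h
    have hk : 2 * k ≤ n := Finset.mem_range_succ_iff.mp hi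
    refine ⟨p - k, Finset.mem_Icc.mpr (by omega), ?_, by omega⟩
    rw [term k hk]
    simpa using h
  · intro q hq h
    have := nonneg_of_ne q h
    rw [Finset.mem_Icc] at hq
    obtain ⟨k, hk⟩ := Int.eq_ofNat_of_zero_le (sub_nonneg.mpr hq.2)
    obtain rfl : q = p - k := by omega
    rw [term k (by omega), show (2 * ((p : ℤ) - (p - k))).toNat = 2 * k by omega]
    simp

/-- **First binomial convolution identity** used in the proof of Lemma `L4.3`:
`Σ_{q=0}^p C(α-q, p-q) C(2α-m, 2q-m)
  = 2^{2p-m} C(α+p-m-1, 2p-m) + 2^{2p-m-1} C(α+p-m-1, 2p-m-1)`. -/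
theorem binomial_convolution_identity_one
    (α p m : ℤ) (hp0 : 0 ≤ p) (hpα : p ≤ α)
    (hm0 : 0 ≤ m) (hm1 : m ≤ 2 * p) (hm2 : m ≤ α + p - 1) :
    ∑ q ∈ Finset.Icc (0 : ℤ) p,
        ichoose (α - q) (p - q) * ichoose (2 * α - m) (2 * q - m)
      = 2 ^ (2 * p - m).toNat * ichoose (α + p - m - 1) (2 * p - m)
        + 2 ^ (2 * p - m - 1).toNat * ichoose (α + p - m - 1) (2 * p - m - 1) := by
  lift p to ℕ using hp0
  obtain ⟨a, ha⟩ := Int.eq_ofNat_of_zero_le (sub_nonneg.mpr hpα)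
  obtain rfl : α = p + a := by omega
  obtain ⟨n, hn⟩ := Int.eq_ofNat_of_zero_le (sub_nonneg.mpr hm1)
  rw [sum_Icc_ichoose_eq_sum_range a p n m hm0 hn, hn]
  obtain ⟨N, hN⟩ : ∃ N, a + n = N + 1 := Nat.exists_eq_add_of_lt (by omega : 0 < a + n) |>.imp
    fun N h ↦ by omega
  rw [show 2 * a + n = N + (a + 1) by omega, sum_choose_mul_choose_even,
    show (p + a + p - m - 1 : ℤ) = N by omega, ichoose_natCast, Int.toNat_natCast]
  cases n with
  | zero =>
    rw [ichoose_of_neg _ (by simp)]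
    simp
  | succ t =>
    obtain rfl : N = a + t := by omega
    rw [show ((t + 1 : ℕ) : ℤ) - 1 = t by simp, ichoose_natCast, Int.toNat_natCast,
      coeff_succ_one_add_pow_mul_mk_choose]
end

section
/- Let α ≥ 1 be an integer, let m be an odd integer with 1 ≤ m ≤ 2α-1, and let p be an integer with (m+1)/2 ≤ p ≤ min(m,α). Then Σ_{q=(m+1)/2}^{p} C(α-q, p-q) · [ C(2α-m, 2q-m) · (2p(α-p) + 2(α-m)(2α-m)) - C(2α-m+1, 2q-m) · (2α-m)(2α-m-p) ] = 0, where C(n,k) denotes the binomial coefficient with the convention C(n,k) = 0 whenever k < 0 or k > n. -/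
/-- Partial sums of the series telescope. -/
theorem sum_choose_mul_odd_choose_partial (n j k : ℕ) (hj : j ≤ n) (hk : k ≤ j) :
    ∑ i ∈ Finset.range (k + 1), ((n - i).choose (j - i) : ℤ) *
        (2 * (n + j + 1) * (2 * n + 1).choose (2 * i + 1)
          - (2 * n + 1) * (2 * n + 2).choose (2 * i + 1))
      = 2 * (j - k) * (n - k).choose (j - k) * (2 * n + 1).choose (2 * k + 1) := by
  induction k with
  | zero =>
    simp
    ring
  | succ k ih =>
    rw [Finset.sum_range_succ, ih (by omega)]
    obtain ⟨e, rfl⟩ := Nat.exists_eq_add_of_le hk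
    obtain ⟨f, rfl⟩ := Nat.exists_eq_add_of_le hj
    set N := 2 * (k + 1 + e + f) + 1 with hN
    have hc := Nat.add_one_mul_choose_eq (e + f) e
    have h₁ := Nat.choose_succ_right_eq N (2 * k + 1)
    have h₂ := Nat.choose_succ_right_eq N (2 * k + 2)
    have h₃ := Nat.choose_succ_succ N (2 * k + 2)
    rw [show N - (2 * k + 1) = 2 * (e + f + 1) by omega] at h₁
    rw [show N - (2 * k + 2) = 2 * (e + f) + 1 by omega] at h₂
    rw [show k + 1 + e + f - k = e + f + 1 by omega, show k + 1 + e - k = e + 1 by omega,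
      show k + 1 + e + f - (k + 1) = e + f by omega, show k + 1 + e - (k + 1) = e by omega,
      show 2 * (k + 1 + e + f) + 2 = N + 1 by omega,
      show 2 * (k + 1) + 1 = 2 * k + 2 + 1 by ring, h₃]
    zify at hc h₁ h₂ hN
    push_cast
    linear_combination (-2 * (N.choose (2 * k + 1) : ℤ)) * hc
      - ((e + f).choose e : ℤ) * h₁ + ((e + f).choose e : ℤ) * h₂

theorem sum_choose_mul_odd_choose (n j : ℕ) (hj : j ≤ n) :
    ∑ i ∈ Finset.range (j + 1), ((n - i).choose (j - i) : ℤ) *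
        (2 * (n + j + 1) * (2 * n + 1).choose (2 * i + 1)
          - (2 * n + 1) * (2 * n + 2).choose (2 * i + 1)) = 0 := by
  simpa using sum_choose_mul_odd_choose_partial n j j hj le_rfl

theorem Int.sum_Icc_add_natCast {M : Type*} [AddCommMonoid M] (f : ℤ → M) (s : ℤ) (j : ℕ) :
    ∑ q ∈ Finset.Icc s (s + j), f q = ∑ i ∈ Finset.range (j + 1), f (s + i) := by
  refine Finset.sum_nbij' (fun q => (q - s).toNat) (fun i => s + i) ?_ ?_ ?_ ?_ ?_
  · intro q hq
    simp only [Finset.mem_Icc, Finset.mem_range] at *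
    omega
  · intro i hi
    simp only [Finset.mem_Icc, Finset.mem_range] at *
    omega
  · intro q hq
    simp only [Finset.mem_Icc] at *
    omega
  · intro i _
    simp
  · intro q hq
    simp only [Finset.mem_Icc] at hq
    congr 1
    omega

/-- **Vanishing of the coefficients `S(m,p)`** in the inductive determination of the
constants `a_j = 2(α-j) a_{j-1}` in the Nicholson-type formula: for `α ≥ 1`, `m` odd
with `1 ≤ m ≤ 2α-1` and `(m+1)/2 ≤ p ≤ min(m,α)`,
`Σ_{q=(m+1)/2}^p C(α-q,p-q) [C(2α-m,2q-m)(2p(α-p)+2(α-m)(2α-m))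
  - C(2α-m+1,2q-m)(2α-m)(2α-m-p)] = 0`. -/
theorem S_m_p_vanishes
    (α m p : ℤ) (hα : 1 ≤ α) (hmodd : Odd m)
    (hm1 : 1 ≤ m) (hm2 : m ≤ 2 * α - 1)
    (hp1 : (m + 1) / 2 ≤ p) (hp2 : p ≤ min m α) :
    ∑ q ∈ Finset.Icc ((m + 1) / 2) p,
        ichoose (α - q) (p - q) *
          (ichoose (2 * α - m) (2 * q - m) *
              (2 * p * (α - p) + 2 * (α - m) * (2 * α - m))
            - ichoose (2 * α - m + 1) (2 * q - m) *
              ((2 * α - m) * (2 * α - m - p)))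
      = 0 := by
  obtain ⟨r, rfl⟩ := hmodd
  obtain ⟨s, rfl⟩ : ∃ s, r = s - 1 := ⟨r + 1, by ring⟩
  rw [show (2 * (s - 1) + 1 + 1) / 2 = s by omega] at hp1 ⊢
  have hpα : p ≤ α := hp2.trans (min_le_right _ _)
  obtain ⟨j, rfl⟩ := Int.exists_add_of_le hp1
  obtain ⟨n, rfl⟩ := Int.exists_add_of_le (hp1.trans hpα)
  have hj : j ≤ n := by omega
  rw [Int.sum_Icc_add_natCast]
  rw [← mul_zero (2 * n + 1 - s - j : ℤ), ← sum_choose_mul_odd_choose n j hj, Finset.mul_sum]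
  refine Finset.sum_congr rfl fun i hi => ?_
  have hij : i ≤ j := Nat.lt_succ_iff.mp (Finset.mem_range.mp hi)
  rw [show s + (n : ℤ) - (s + i) = (n - i : ℕ) by omega,
    show s + (j : ℤ) - (s + i) = (j - i : ℕ) by omega,
    show 2 * (s + (n : ℤ)) - (2 * (s - 1) + 1) = (2 * n + 1 : ℕ) by push_cast; ring,
    show (((2 * n + 1 : ℕ) : ℤ) + 1) = (2 * n + 2 : ℕ) by push_cast; ring,
    show 2 * (s + (i : ℤ)) - (2 * (s - 1) + 1) = (2 * i + 1 : ℕ) by push_cast; ring]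
  simp only [ichoose_natCast]
  push_cast
  ring
end

section
/- Let F, G ∈ C^∞((0,∞)) and let D denote the operator Dφ(t) = (1/t) φ'(t). Suppose D^j G ≡ 0 on (0,∞) for every j ≥ 3. Then for every integer k ≥ 1 and every t > 0, D^k (F ∘ G)(t) = Σ_{j=⌈k/2⌉}^{k} ( k! / ((2j-k)! (k-j)! 2^{k-j}) ) · F^{(j)}(G(t)) · (DG(t))^{2j-k} · (D^2 G(t))^{k-j}, where F^{(j)} denotes the j-th ordinary derivative of F. -/
/-- The differential operator `D = (1/t) d/dt`. -/
noncomputable def Dop (φ : ℝ → ℝ) : ℝ → ℝ := fun t => (1 / t) * deriv φ t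

section Coefficients

open scoped Nat

/-- The coefficient `k! / ((k - 2m)! m! 2^m)` of the formula, extended by zero to `k < 2m`. -/
noncomputable def faaDiBrunoCoeff (k m : ℕ) : ℝ :=
  if 2 * m ≤ k then (k ! : ℝ) / (((k - 2 * m)! : ℝ) * (m ! : ℝ) * 2 ^ m) else 0

lemma faaDiBrunoCoeff_of_le {k m : ℕ} (h : 2 * m ≤ k) :
    faaDiBrunoCoeff k m = (k ! : ℝ) / (((k - 2 * m)! : ℝ) * (m ! : ℝ) * 2 ^ m) :=
  if_pos h

lemma faaDiBrunoCoeff_of_lt {k m : ℕ} (h : k < 2 * m) : faaDiBrunoCoeff k m = 0 :=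
  if_neg h.not_ge

lemma faaDiBrunoCoeff_zero_right (k : ℕ) : faaDiBrunoCoeff k 0 = 1 := by
  simp [faaDiBrunoCoeff, Nat.factorial_ne_zero]

lemma faaDiBrunoCoeff_succ_succ (k m : ℕ) :
    faaDiBrunoCoeff (k + 1) (m + 1) =
      faaDiBrunoCoeff k (m + 1) + ((k - 2 * m : ℕ) : ℝ) * faaDiBrunoCoeff k m := by
  rcases lt_or_ge k (2 * m + 2) with h | h
  · rw [faaDiBrunoCoeff_of_lt (show k < 2 * (m + 1) by omega), zero_add]
    rcases (show k ≤ 2 * m ∨ k = 2 * m + 1 by omega) with h' | rfl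
    · rw [faaDiBrunoCoeff_of_lt (by omega), Nat.sub_eq_zero_of_le h', Nat.cast_zero, zero_mul]
    · rw [faaDiBrunoCoeff_of_le (by omega), faaDiBrunoCoeff_of_le (by omega),
        show 2 * m + 1 + 1 - 2 * (m + 1) = 0 by omega, show 2 * m + 1 - 2 * m = 1 by omega,
        Nat.factorial_succ (2 * m + 1), Nat.factorial_succ m]
      push_cast
      simp only [Nat.factorial_zero, Nat.factorial_one, Nat.cast_one]
      have := Nat.factorial_ne_zero m
      field_simp
      ring
  · obtain ⟨r, rfl⟩ := Nat.exists_eq_add_of_le h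
    rw [faaDiBrunoCoeff_of_le (by omega), faaDiBrunoCoeff_of_le (by omega),
      faaDiBrunoCoeff_of_le (by omega), show 2 * m + 2 + r + 1 - 2 * (m + 1) = r + 1 by omega,
      show 2 * m + 2 + r - 2 * (m + 1) = r by omega,
      show 2 * m + 2 + r - 2 * m = r + 1 + 1 by omega,
      Nat.factorial_succ (2 * m + 2 + r), Nat.factorial_succ (r + 1), Nat.factorial_succ r,
      Nat.factorial_succ m]
    have := Nat.factorial_ne_zero m
    have := Nat.factorial_ne_zero r
    push_cast
    field_simp
    ring

lemma sum_faaDiBrunoCoeff_succ (f : ℕ → ℝ) (a b : ℝ) (k : ℕ) :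
    ∑ m ∈ Finset.range (k + 2),
        faaDiBrunoCoeff (k + 1) m * f (k + 1 - m) * a ^ (k + 1 - 2 * m) * b ^ m =
      ∑ m ∈ Finset.range (k + 1), faaDiBrunoCoeff k m *
        (f (k - m + 1) * a * a ^ (k - 2 * m) +
          f (k - m) * (((k - 2 * m : ℕ) : ℝ) * a ^ (k - 2 * m - 1) * b)) * b ^ m := by
  have hshift : ∀ m, faaDiBrunoCoeff k m * (f (k - m + 1) * a * a ^ (k - 2 * m)) * b ^ m =
      faaDiBrunoCoeff k m * f (k + 1 - m) * a ^ (k + 1 - 2 * m) * b ^ m := by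
    intro m
    rcases lt_or_ge k (2 * m) with h | h
    · simp [faaDiBrunoCoeff_of_lt h]
    · rw [show k + 1 - m = k - m + 1 by omega, show k + 1 - 2 * m = k - 2 * m + 1 by omega]
      ring
  have hextend : ∑ m ∈ Finset.range (k + 1),
        faaDiBrunoCoeff k m * f (k + 1 - m) * a ^ (k + 1 - 2 * m) * b ^ m =
      ∑ m ∈ Finset.range (k + 2),
        faaDiBrunoCoeff k m * f (k + 1 - m) * a ^ (k + 1 - 2 * m) * b ^ m := by
    rw [Finset.sum_range_succ _ (k + 1), faaDiBrunoCoeff_of_lt (by omega)]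
    simp
  simp only [mul_add, add_mul, Finset.sum_add_distrib, hshift]
  rw [hextend, Finset.sum_range_succ' _ (k + 1), Finset.sum_range_succ' _ (k + 1)]
  simp only [faaDiBrunoCoeff_succ_succ, faaDiBrunoCoeff_zero_right, add_mul,
    Finset.sum_add_distrib]
  rw [add_right_comm]
  congr 1
  refine Finset.sum_congr rfl fun m _ => ?_
  rw [show k + 1 - (m + 1) = k - m by omega, show k + 1 - 2 * (m + 1) = k - 2 * m - 1 by omega]
  ring

lemma sum_Icc_eq_sum_faaDiBrunoCoeff (f : ℕ → ℝ) (a b : ℝ) (k : ℕ) :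
    ∑ j ∈ Finset.Icc ((k + 1) / 2) k,
        ((k ! : ℝ) / (((2 * j - k)! : ℝ) * ((k - j)! : ℝ) * 2 ^ (k - j))) *
          f j * a ^ (2 * j - k) * b ^ (k - j) =
      ∑ m ∈ Finset.range (k + 1), faaDiBrunoCoeff k m * f (k - m) * a ^ (k - 2 * m) * b ^ m := by
  rw [← Finset.sum_subset (s₁ := (Finset.range (k + 1)).filter (2 * · ≤ k))
    (Finset.filter_subset _ _)]
  · refine Finset.sum_nbij' (k - ·) (k - ·) ?_ ?_ ?_ ?_ ?_
    · intro j hj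
      simp only [Finset.mem_Icc, Finset.mem_filter, Finset.mem_range] at hj ⊢
      omega
    · intro m hm
      simp only [Finset.mem_Icc, Finset.mem_filter, Finset.mem_range] at hm ⊢
      omega
    · intro j hj
      simp only [Finset.mem_Icc] at hj
      omega
    · intro m hm
      simp only [Finset.mem_filter, Finset.mem_range] at hm
      omega
    · intro j hj
      simp only [Finset.mem_Icc] at hj
      rw [faaDiBrunoCoeff_of_le (by omega), show k - (k - j) = j by omega,
        show k - 2 * (k - j) = 2 * j - k by omega]
  · intro m hm hm'
    simp only [Finset.mem_filter, not_and, not_le] at hm'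
    simp [faaDiBrunoCoeff_of_lt (hm' hm)]

end Coefficients

lemma ContDiffOn.Dop {φ : ℝ → ℝ} (h : ContDiffOn ℝ (⊤ : ℕ∞) φ (Set.Ioi 0)) :
    ContDiffOn ℝ (⊤ : ℕ∞) (Dop φ) (Set.Ioi 0) :=
  (contDiffOn_const.div contDiffOn_id fun _ ht => (Set.mem_Ioi.1 ht).ne').mul
    (h.deriv_of_isOpen isOpen_Ioi (by simp))

lemma ContDiffOn.iteratedDeriv_of_isOpen {φ : ℝ → ℝ} {s : Set ℝ}
    (h : ContDiffOn ℝ (⊤ : ℕ∞) φ s) (hs : IsOpen s) (n : ℕ) :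
    ContDiffOn ℝ (⊤ : ℕ∞) (iteratedDeriv n φ) s := by
  induction n with
  | zero => simpa using h
  | succ n ih =>
    rw [iteratedDeriv_succ]
    exact ih.deriv_of_isOpen hs (by simp)

lemma ContDiffOn.hasDerivAt_of_isOpen {φ : ℝ → ℝ} {s : Set ℝ} {t : ℝ}
    (h : ContDiffOn ℝ (⊤ : ℕ∞) φ s) (hs : IsOpen s) (ht : t ∈ s) :
    HasDerivAt φ (deriv φ t) t :=
  ((h.differentiableOn (by simp)).differentiableAt (hs.mem_nhds ht)).hasDerivAt

lemma ContDiffOn.hasDerivAt_Dop {φ : ℝ → ℝ} {t : ℝ}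
    (h : ContDiffOn ℝ (⊤ : ℕ∞) φ (Set.Ioi 0)) (ht : 0 < t) :
    HasDerivAt φ (t * _root_.Dop φ t) t := by
  convert h.hasDerivAt_of_isOpen isOpen_Ioi ht using 1
  simp only [_root_.Dop]
  field_simp

lemma HasDerivAt.Dop_eq {φ : ℝ → ℝ} {t c : ℝ} (h : HasDerivAt φ (t * c) t) (ht : 0 < t) :
    Dop φ t = c := by
  simp only [Dop, h.deriv]
  field_simp

lemma Filter.EventuallyEq.Dop_eq {φ ψ : ℝ → ℝ} {t : ℝ} (h : φ =ᶠ[nhds t] ψ) :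
    Dop φ t = Dop ψ t := by
  simp only [Dop, h.deriv_eq]

/-- The formula with the sum indexed by `m = k - j`. -/
lemma iterate_Dop_comp_eq_sum {F G : ℝ → ℝ}
    (hF : ContDiffOn ℝ (⊤ : ℕ∞) F (Set.Ioi 0))
    (hG : ContDiffOn ℝ (⊤ : ℕ∞) G (Set.Ioi 0))
    (hmaps : Set.MapsTo G (Set.Ioi 0) (Set.Ioi 0))
    (hG3 : ∀ t : ℝ, 0 < t → Dop (Dop (Dop G)) t = 0) (k : ℕ) {t : ℝ} (ht : 0 < t) :
    Dop^[k] (F ∘ G) t = ∑ m ∈ Finset.range (k + 1), faaDiBrunoCoeff k m *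
      iteratedDeriv (k - m) F (G t) * Dop G t ^ (k - 2 * m) * Dop (Dop G) t ^ m := by
  induction k generalizing t with
  | zero => simp [faaDiBrunoCoeff_zero_right]
  | succ k ih =>
    have hev : Dop^[k] (F ∘ G) =ᶠ[nhds t] fun u => ∑ m ∈ Finset.range (k + 1),
        faaDiBrunoCoeff k m * iteratedDeriv (k - m) F (G u) * Dop G u ^ (k - 2 * m) *
          Dop (Dop G) u ^ m := by
      filter_upwards [Ioi_mem_nhds ht] with u hu using ih hu
    rw [Function.iterate_succ_apply', hev.Dop_eq,
      sum_faaDiBrunoCoeff_succ (fun j => iteratedDeriv j F (G t))]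
    refine HasDerivAt.Dop_eq ?_ ht
    rw [Finset.mul_sum]
    refine HasDerivAt.fun_sum fun m _ => ?_
    have hFm : HasDerivAt (fun u => iteratedDeriv (k - m) F (G u))
        (iteratedDeriv (k - m + 1) F (G t) * (t * Dop G t)) t := by
      rw [iteratedDeriv_succ]
      exact ((hF.iteratedDeriv_of_isOpen isOpen_Ioi (k - m)).hasDerivAt_of_isOpen isOpen_Ioi
        (hmaps ht)).comp t (hG.hasDerivAt_Dop ht)
    have hA := (hG.Dop.hasDerivAt_Dop ht).fun_pow (k - 2 * m)
    have hB := (hG.Dop.Dop.hasDerivAt_Dop ht).fun_pow m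
    rw [hG3 t ht] at hB
    refine (((hFm.const_mul (faaDiBrunoCoeff k m)).fun_mul hA).fun_mul hB).congr_deriv ?_
    ring

/-- **Faà di Bruno formula for `D`-derivatives** (Lemma `L2.3`), in the special case
where the inner function `G` satisfies `D^j G = 0` for `j ≥ 3`:  for smooth
`F, G : (0,∞) → (0,∞) → ℝ`, every `k ≥ 1` and `t > 0`,
`D^k (F ∘ G)(t) = Σ_{j ≥ k/2}^k (k!/((2j-k)!(k-j)! 2^{k-j})) F^{(j)}(G(t))
  (DG(t))^{2j-k} (D²G(t))^{k-j}`. -/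
theorem faa_di_bruno_for_D
    (F G : ℝ → ℝ)
    (hF : ContDiffOn ℝ (⊤ : ℕ∞) F (Set.Ioi 0))
    (hG : ContDiffOn ℝ (⊤ : ℕ∞) G (Set.Ioi 0))
    (hmaps : Set.MapsTo G (Set.Ioi 0) (Set.Ioi 0))
    (hG3 : ∀ j : ℕ, 3 ≤ j → ∀ t : ℝ, 0 < t → Dop^[j] G t = 0) :
    ∀ k : ℕ, 1 ≤ k → ∀ t : ℝ, 0 < t →
      Dop^[k] (F ∘ G) t
        = ∑ j ∈ Finset.Icc ((k + 1) / 2) k,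
            ((Nat.factorial k : ℝ) /
                ((Nat.factorial (2 * j - k) : ℝ) * (Nat.factorial (k - j) : ℝ) *
                  2 ^ (k - j))) *
              iteratedDeriv j F (G t) * (Dop G t) ^ (2 * j - k) *
              (Dop^[2] G t) ^ (k - j) := by
  intro k _ t ht
  rw [iterate_Dop_comp_eq_sum hF hG hmaps (hG3 3 le_rfl) k ht]
  exact (sum_Icc_eq_sum_faaDiBrunoCoeff (fun j => iteratedDeriv j F (G t)) _ _ k).symm
end
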